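/- Corollary of Theorem 4.1 (eigenvalues in components of the pseudospectrum). Let N ≥ 1, let E = EuclideanSpace ℂ (Fin N), and let A : E →L[ℂ] E be a linear operator. Let ε > 0 and define the ε-pseudospectrum σ_ε(A) = spectrum ℂ A ∪ { w ∈ ℂ : w ∉ spectrum ℂ A and ‖(A − w I)⁻¹‖ > 1/ε }. Then for every z ∈ σ_ε(A), the connected component of z inside σ_ε(A) contains an eigenvalue of A; i.e. connectedComponentIn σ_ε(A) z ∩ spectrum ℂ A ≠ ∅. -/

import Mathlib

theorem pseudo_aux {B : Type*} [NormedRing B] [NormedAlgebra ℂ B] [CompleteSpace B]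
    [Nontrivial B] [NormOneClass B] (A : B) (ε : ℝ) (hε : 0 < ε) (z : ℂ) (S : Set ℂ)
    (hS : S = spectrum ℂ A ∪ {w : ℂ | w ∉ spectrum ℂ A ∧ ‖resolvent A w‖ > ε⁻¹})
    (hz : z ∈ S) : (connectedComponentIn S z ∩ spectrum ℂ A).Nonempty := by
  have hdiff : ∀ w ∉ spectrum ℂ A, DifferentiableAt ℂ (resolvent A) w := fun w hw =>
    (spectrum.hasDerivAt_resolvent_const_left (spectrum.notMem_iff.1 hw)).differentiableAt
  have hclosed : IsClosed (spectrum ℂ A) := spectrum.isClosed A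
  have hSopen : IsOpen S := by
    rw [isOpen_iff_mem_nhds]
    intro l hl
    rw [hS] at hl
    rcases hl with hl | ⟨hl, hl2⟩
    · refine Filter.mem_of_superset (Metric.ball_mem_nhds l hε) ?_
      intro w hw
      rw [hS]
      by_cases hws : w ∈ spectrum ℂ A
      · exact Or.inl hws
      refine Or.inr ⟨hws, ?_⟩
      by_contra hcon
      have hcon : ‖resolvent A w‖ ≤ ε⁻¹ := not_lt.1 hcon
      have hu := spectrum.notMem_iff.1 hws
      rw [spectrum.resolvent_eq hu] at hcon
      have hpos : 0 < ‖((hu.unit⁻¹ : Bˣ) : B)‖ := norm_pos_iff.2 (Units.ne_zero _)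
      apply hl
      refine ⟨hu.unit.ofNearby (algebraMap ℂ B l - A) ?_, rfl⟩
      have h1 : algebraMap ℂ B l - A - (hu.unit : B) = algebraMap ℂ B (l - w) := by
        rw [map_sub]; simp
      rw [h1, norm_algebraMap']
      have h2 : ‖l - w‖ < ε := by
        rw [← dist_eq_norm, dist_comm]; exact hw
      refine h2.trans_le ?_
      exact (le_inv_comm₀ hpos hε).1 hcon
    · have h1 : ∀ᶠ w in nhds l, w ∉ spectrum ℂ A := hclosed.isOpen_compl.mem_nhds hl
      have h2 : ∀ᶠ w in nhds l, ε⁻¹ < ‖resolvent A w‖ :=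
        (hdiff l hl).continuousAt.norm.eventually_const_lt hl2
      filter_upwards [h1, h2] with w a b
      rw [hS]
      exact Or.inr ⟨a, b⟩
  have hSb : Bornology.IsBounded S := by
    rw [hS]
    refine (spectrum.isCompact A).isBounded.union ?_
    have h := (spectrum.resolvent_tendsto_cobounded (𝕜 := ℂ) A).norm
    rw [norm_zero] at h
    have h := h.eventually_lt_const (inv_pos.2 hε)
    rw [Bornology.isBounded_def]
    filter_upwards [h] with w hw hw2
    exact lt_asymm hw hw2.2
  by_contra hne
  rw [Set.not_nonempty_iff_eq_empty, ← Set.disjoint_iff_inter_eq_empty] at hne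
  set U := connectedComponentIn S z with hU
  have hUS : U ⊆ S := connectedComponentIn_subset S z
  have hUo : IsOpen U := hSopen.connectedComponentIn
  have hcl : ∀ p ∈ closure U, p ∈ S → p ∈ U := by
    intro p hp hpS
    obtain ⟨q, hq1, hq2⟩ := mem_closure_iff.1 hp _
      (hSopen.connectedComponentIn (x := p)) (mem_connectedComponentIn hpS)
    have e1 := connectedComponentIn_eq hq1
    have e2 := connectedComponentIn_eq hq2
    rw [hU, e2, ← e1]
    exact mem_connectedComponentIn hpS
  have hclr : ∀ p ∈ closure U, p ∉ spectrum ℂ A := by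
    intro p hp hps
    exact Set.disjoint_left.1 hne (hcl p hp (by rw [hS]; exact Or.inl hps)) hps
  have hd : DiffContOnCl ℂ (resolvent A) U :=
    DifferentiableOn.diffContOnCl fun p hp => (hdiff p (hclr p hp)).differentiableWithinAt
  have hzU : z ∈ U := mem_connectedComponentIn hz
  have hle : ‖resolvent A z‖ ≤ ε⁻¹ := by
    refine Complex.norm_le_of_forall_mem_frontier_norm_le (hSb.subset hUS) hd ?_
      (subset_closure hzU)
    intro p hp
    by_contra hcon
    have hpS : p ∈ S := by
      rw [hS]; exact Or.inr ⟨hclr p hp.1, not_le.1 hcon⟩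
    have := hcl p hp.1 hpS
    rw [hUo.frontier_eq] at hp
    exact hp.2 this
  rw [hS] at hz
  rcases hz with h | h
  · exact hclr z (subset_closure hzU) h
  · exact absurd hle (not_le.2 h.2)

theorem norm_inverse_aux {B : Type*} [NormedRing B] [NormedAlgebra ℂ B] (A : B) (w : ℂ) :
    ‖Ring.inverse (A - algebraMap ℂ B w)‖ = ‖resolvent A w‖ := by
  have h : A - algebraMap ℂ B w = -(algebraMap ℂ B w - A) := by abel
  rw [h, resolvent]
  by_cases hu : IsUnit (algebraMap ℂ B w - A)
  · obtain ⟨u, hu⟩ := hu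
    rw [← hu, ← Units.val_neg, Ring.inverse_unit, Ring.inverse_unit]
    simp
  · rw [Ring.inverse_non_unit _ hu, Ring.inverse_non_unit _ (fun h2 => hu ((IsUnit.neg_iff _).1 h2))]

/-- Corollary of Theorem 4.1: every connected component of the ε-pseudospectrum
of a matrix contains an eigenvalue. -/
theorem pseudospectrum_component_contains_eigenvalue
    (N : ℕ) (hN : 1 ≤ N)
    (A : EuclideanSpace ℂ (Fin N) →L[ℂ] EuclideanSpace ℂ (Fin N))
    (ε : ℝ) (hε : 0 < ε)
    (z : ℂ)
    (hz : z ∈ spectrum ℂ A ∪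
      {w : ℂ | w ∉ spectrum ℂ A ∧
        ‖Ring.inverse (A - algebraMap ℂ
          (EuclideanSpace ℂ (Fin N) →L[ℂ] EuclideanSpace ℂ (Fin N)) w)‖ > ε⁻¹}) :
    (connectedComponentIn
        (spectrum ℂ A ∪
          {w : ℂ | w ∉ spectrum ℂ A ∧
            ‖Ring.inverse (A - algebraMap ℂ
              (EuclideanSpace ℂ (Fin N) →L[ℂ] EuclideanSpace ℂ (Fin N)) w)‖ > ε⁻¹})
        z ∩ spectrum ℂ A).Nonempty := by
  have : Nonempty (Fin N) := ⟨⟨0, hN⟩⟩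
  have : Nontrivial (EuclideanSpace ℂ (Fin N)) := inferInstance
  simp only [norm_inverse_aux] at hz ⊢
  exact pseudo_aux A ε hε z _ rfl hz
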